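/- arXiv:2211.00865 — 4 statements merged into one kernel-verified Lean document; each statement's English description precedes it below -/
import Mathlib

section
/- Let M be a cyclic p-group with an effective (faithful) action by automorphisms of an elementary abelian p-group E of rank at least two. Then M is not cohomologically trivial as a ZE-module; that is, there exist a subgroup H ≤ E and an integer n with Ĥⁿ(H; M) ≠ 0. -/
/-!  Elementary (hands-on) description of the vanishing of Tate cohomology groups
`Ĥⁿ(Q; M)` of a finite group `Q` acting by automorphisms on an abelian group `M`,
for all integers `n`:
* for `n ≥ 1`, `Ĥⁿ = Hⁿ` is described by the standard inhomogeneous cochain differential;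
* `Ĥ⁰` is the fixed points modulo the image of the norm (trace) map;
* `Ĥ⁻¹` is the kernel of the norm modulo the subgroup generated by `q • a - a`;
* for `n ≤ -2`, `Ĥⁿ = H₋ₙ₋₁` is described by the standard inhomogeneous chain differential.
-/

section TateMachinery

variable (Q : Type*) [Group Q] [Fintype Q] (M : Type*) [AddCommGroup M]
  [DistribMulAction Q M]

/-- The differential of the standard inhomogeneous cochain complex computing the
cohomology of `Q` with coefficients in `M`. -/
def tateCochainD (n : ℕ) (f : (Fin n → Q) → M) : (Fin (n + 1) → Q) → M :=
  fun g =>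
    g 0 • f (fun i => g i.succ) +
      ∑ j : Fin (n + 1), ((-1 : ℤ) ^ ((j : ℕ) + 1)) • f (Fin.contractNth j (· * ·) g)

/-- The differential of the standard inhomogeneous chain complex computing the
homology of `Q` with coefficients in `M` (for finite `Q`, chains in degree `n` are
functions `(Fin n → Q) → M`). -/
def tateChainD (n : ℕ) (c : (Fin (n + 1) → Q) → M) : (Fin n → Q) → M :=
  fun h =>
    (∑ q : Q, q⁻¹ • c (Fin.cons q h)) +
      (∑ j : Fin n, ((-1 : ℤ) ^ ((j : ℕ) + 1)) •
        ∑ a : Q, c (Fin.insertNth j.castSucc a (Function.update h j (a⁻¹ * h j)))) +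
      ((-1 : ℤ) ^ (n + 1)) • ∑ q : Q, c (Fin.snoc h q)

/-- `tateVanishes Q M n` says that the Tate cohomology group `Ĥⁿ(Q; M)` vanishes. -/
def tateVanishes : ℤ → Prop
  | Int.ofNat 0 =>
      ∀ m : M, (∀ q : Q, q • m = m) → ∃ x : M, ∑ q : Q, q • x = m
  | Int.ofNat (n + 1) =>
      ∀ f : (Fin (n + 1) → Q) → M, tateCochainD Q M (n + 1) f = 0 →
        ∃ g : (Fin n → Q) → M, tateCochainD Q M n g = f
  | Int.negSucc 0 =>
      ∀ m : M, (∑ q : Q, q • m) = 0 →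
        m ∈ AddSubgroup.closure {x : M | ∃ (q : Q) (a : M), x = q • a - a}
  | Int.negSucc (n + 1) =>
      ∀ c : (Fin (n + 1) → Q) → M, tateChainD Q M n c = 0 →
        ∃ b : (Fin (n + 2) → Q) → M, tateChainD Q M (n + 1) b = c

/-- `M` is a cohomologically trivial `Q`-module: all Tate cohomology groups
`Ĥⁿ(H; M)` vanish, for every subgroup `H ≤ Q` and every integer `n`. -/
def IsCohomologicallyTrivial : Prop :=
  ∀ (H : Subgroup Q) (n : ℤ),
    letI : Fintype H := Fintype.ofFinite H
    letI : DistribMulAction H M := DistribMulAction.compHom M H.subtype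
    tateVanishes H M n

end TateMachinery

theorem Int.two_pow_dvd_sub_one_or_add_one {k : ℕ} {a : ℤ}
    (h : (2 : ℤ) ^ (k + 1) ∣ (a - 1) * (a + 1)) : (2 : ℤ) ^ k ∣ a - 1 ∨ (2 : ℤ) ^ k ∣ a + 1 := by
  rcases k with _ | k
  · simp
  have hodd : Odd a := by
    have h2 : (2 : ℤ) ∣ (a - 1) * (a + 1) := (dvd_pow_self 2 (by omega)).trans h
    rcases Int.prime_two.dvd_or_dvd h2 with h2 | h2
    · exact Int.odd_iff.2 (by omega)
    · exact Int.odd_iff.2 (by omega)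
  obtain ⟨b, rfl⟩ := hodd
  have hb : (2 : ℤ) ^ k ∣ b * (b + 1) := by
    refine (mul_dvd_mul_iff_left (a := (4 : ℤ)) (by norm_num)).1 ?_
    rwa [show (4 : ℤ) * 2 ^ k = 2 ^ (k + 1 + 1) by ring,
      show 4 * (b * (b + 1)) = (2 * b + 1 - 1) * (2 * b + 1 + 1) by ring]
  by_cases hb2 : (2 : ℤ) ∣ b
  · obtain ⟨c, hc⟩ := Int.prime_two.pow_dvd_of_dvd_mul_right k (by omega) hb
    exact .inl ⟨c, by rw [hc]; ring⟩
  · obtain ⟨c, hc⟩ := Int.prime_two.pow_dvd_of_dvd_mul_left k hb2 hb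
    exact .inr ⟨c, by rw [pow_succ]; linear_combination 2 * hc⟩

/-- The square roots of `1` in `ZMod (2 ^ (k + 1))`. -/
theorem ZMod.mem_of_sq_eq_one_of_two_pow {k : ℕ} {x : ZMod (2 ^ (k + 1))} (hx : x ^ 2 = 1) :
    x ∈ ({1, -1, 1 + 2 ^ k, -1 + 2 ^ k} : Finset (ZMod (2 ^ (k + 1)))) := by
  have h0 : (2 : ZMod (2 ^ (k + 1))) ^ (k + 1) = 0 := by
    exact_mod_cast ZMod.natCast_self (2 ^ (k + 1))
  have key (c : ℤ) : (2 : ZMod (2 ^ (k + 1))) ^ k * c = 0 ∨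
      (2 : ZMod (2 ^ (k + 1))) ^ k * c = 2 ^ k := by
    rcases Int.even_or_odd' c with ⟨d, rfl | rfl⟩
    · left
      push_cast
      linear_combination (d : ZMod (2 ^ (k + 1))) * h0
    · right
      push_cast
      linear_combination (d : ZMod (2 ^ (k + 1))) * h0
  obtain ⟨a, rfl⟩ := ZMod.intCast_surjective x
  have hdvd : (2 : ℤ) ^ (k + 1) ∣ (a - 1) * (a + 1) := by
    have := (ZMod.intCast_zmod_eq_zero_iff_dvd ((a - 1) * (a + 1)) (2 ^ (k + 1))).1
      (by push_cast; linear_combination hx)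
    exact_mod_cast this
  simp only [Finset.mem_insert, Finset.mem_singleton]
  rcases Int.two_pow_dvd_sub_one_or_add_one hdvd with ⟨c, hc⟩ | ⟨c, hc⟩
  · have hc' : (a : ZMod (2 ^ (k + 1))) = 1 + 2 ^ k * c := by
      rw [eq_add_of_sub_eq' hc]; push_cast; rfl
    rcases key c with h | h <;> simp [hc', h]
  · have hc' : (a : ZMod (2 ^ (k + 1))) = -1 + 2 ^ k * c := by
      rw [eq_sub_of_add_eq hc]; push_cast; ring
    rcases key c with h | h <;> simp [hc', h]

/-- An action on a cyclic group is given by multiplication by scalars. -/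
theorem IsAddCyclic.exists_monoidHom_zmod {M E : Type*} [AddCommGroup M] (hcyc : IsAddCyclic M)
    [Group E] [DistribMulAction E M] :
    ∃ (ψ : ZMod (Nat.card M) ≃+ M) (u : E →* ZMod (Nat.card M)), ∀ e x, e • ψ x = ψ (u e * x) := by
  let ψ := zmodAddCyclicAddEquiv hcyc
  have key (e : E) (x : ZMod (Nat.card M)) : e • ψ x = ψ (ψ.symm (e • ψ 1) * x) := by
    obtain ⟨k, rfl⟩ := ZMod.intCast_surjective x
    have h (y : ZMod (Nat.card M)) : y * (k : ZMod (Nat.card M)) = k • y := by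
      rw [zsmul_eq_mul, mul_comm]
    rw [h, map_zsmul, ψ.apply_symm_apply, ← one_mul (k : ZMod (Nat.card M)), h, map_zsmul]
    exact map_zsmul (DistribSMul.toAddMonoidHom M e) k _
  refine ⟨ψ, ⟨⟨fun e => ψ.symm (e • ψ 1), ?_⟩, ?_⟩, key⟩
  · simp
  · intro a b
    apply ψ.injective
    simp only [← key, AddEquiv.apply_symm_apply, mul_smul]

/-- If an element acts by inversion, then triviality of `Ĥ⁰` of the subgroup it generates
excludes elements of order two in the module. -/
theorem not_isCohomologicallyTrivial_of_smul_eq_neg {E M : Type*} [Group E] [Fintype E]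
    [AddCommGroup M] [DistribMulAction E M] {e : E} (he : e ≠ 1) (he2 : e * e = 1)
    (hneg : ∀ m : M, e • m = -m) {m : M} (hm : m ≠ 0) (hm2 : m + m = 0) :
    ¬ IsCohomologicallyTrivial E M := by
  classical
  intro hct
  let _ : Fintype (Subgroup.zpowers e) := Fintype.ofFinite _
  let _ : DistribMulAction (Subgroup.zpowers e) M :=
    DistribMulAction.compHom M (Subgroup.zpowers e).subtype
  have h0 : ∀ m : M, (∀ q : Subgroup.zpowers e, q • m = m) →
      ∃ x : M, ∑ q : Subgroup.zpowers e, q • x = m := hct (Subgroup.zpowers e) 0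
  let g : Subgroup.zpowers e := ⟨e, Subgroup.mem_zpowers e⟩
  have hg (x : M) : g • x = -x := hneg x
  have hone (x : M) : (1 : Subgroup.zpowers e) • x = x := one_smul E x
  have hmem (q : Subgroup.zpowers e) : q = 1 ∨ q = g := by
    obtain ⟨_, k, rfl⟩ := q
    have hee : e ^ (2 : ℤ) = 1 := by rw [zpow_two, he2]
    rcases Int.even_or_odd' k with ⟨d, rfl | rfl⟩
    · left; ext; simp [zpow_mul, hee]
    · right; ext; simp [g, zpow_add, zpow_mul, hee]
  have huniv : (Finset.univ : Finset (Subgroup.zpowers e)) = {1, g} := by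
    ext q; simpa using hmem q
  have hg1 : (1 : Subgroup.zpowers e) ≠ g := fun h => he (congrArg Subtype.val h).symm
  obtain ⟨x, hx⟩ := h0 m fun q => by
    rcases hmem q with rfl | rfl
    · exact hone m
    · rw [hg]; exact neg_eq_of_add_eq_zero_left hm2
  rw [huniv, Finset.sum_pair hg1, hone, hg, add_neg_cancel] at hx
  exact hm hx.symm

/-- Let `M` be a cyclic `p`-group with an effective (faithful) action by
automorphisms of an elementary abelian `p`-group `E` of rank at least two. Then `M` is not
cohomologically trivial as a `ℤE`-module. -/
theorem not_cohomologicallyTrivial_of_cyclic (p : ℕ) (hp : p.Prime)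
    (M : Type*) [AddCommGroup M] [Finite M]
    (hcyc : IsAddCyclic M) (hMp : ∃ n : ℕ, Nat.card M = p ^ n)
    (E : Type*) [Group E] [Fintype E]
    (hE : ∃ r : ℕ, 2 ≤ r ∧ Nonempty (E ≃* (Fin r → Multiplicative (ZMod p))))
    [DistribMulAction E M]
    (hfaithful : ∀ e : E, (∀ m : M, e • m = m) → e = 1) :
    ¬ IsCohomologicallyTrivial E M := by
  classical
  obtain ⟨r, hr, ⟨f⟩⟩ := hE
  obtain ⟨n, hn⟩ := hMp
  have : Fact p.Prime := ⟨hp⟩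
  have hpow (e : E) : e ^ p = 1 := by
    apply f.injective
    ext i
    simp [toAdd_pow]
  have hcard : Nat.card E = p ^ r := by
    rw [Nat.card_congr f.toEquiv]
    simp
  obtain ⟨ψ, u, hu⟩ : ∃ (ψ : ZMod (p ^ n) ≃+ M) (u : E →* ZMod (p ^ n)),
      ∀ e x, e • ψ x = ψ (u e * x) := hn ▸ hcyc.exists_monoidHom_zmod
  have huinj : Function.Injective u := by
    intro a b hab
    refine inv_mul_eq_one.1 (hfaithful _ fun m => ?_)
    obtain ⟨x, rfl⟩ := ψ.surjective m
    rw [mul_smul, hu b, ← hab, ← hu a, inv_smul_smul]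
  rcases eq_or_ne p 2 with rfl | hp2
  · have hcardE : 4 ≤ Fintype.card E := by
      rw [← Nat.card_eq_fintype_card, hcard]
      exact Nat.pow_le_pow_right two_pos hr
    rcases n with _ | k
    · have : Subsingleton (ZMod (2 ^ 0)) := inferInstanceAs (Subsingleton (Fin 1))
      have : Subsingleton E := huinj.subsingleton
      have := Fintype.card_le_one_iff_subsingleton.2 this
      omega
    have hle : ({1, -1, 1 + 2 ^ k, -1 + 2 ^ k} : Finset (ZMod (2 ^ (k + 1)))).card ≤
        (Finset.univ.image u).card := by
      rw [Finset.card_image_of_injective _ huinj]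
      exact Finset.card_le_four.trans hcardE
    have himage := Finset.eq_of_subset_of_card_le (s := Finset.univ.image u)
      (fun x hx => by
        obtain ⟨e, -, rfl⟩ := Finset.mem_image.1 hx
        exact ZMod.mem_of_sq_eq_one_of_two_pow (by rw [← map_pow, hpow, map_one])) hle
    obtain ⟨e, -, he⟩ := Finset.mem_image.1
      (show (-1 : ZMod (2 ^ (k + 1))) ∈ Finset.univ.image u by rw [himage]; simp)
    have hne : e ≠ 1 := by
      rintro rfl
      rw [map_one] at he
      have h4 : 4 ≤ (Finset.univ.image u).card := by
        rwa [Finset.card_image_of_injective _ huinj]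
      have h2 : ({1, 1 + 2 ^ k} : Finset (ZMod (2 ^ (k + 1)))).card ≤ 2 := Finset.card_le_two
      simp only [himage, ← he, Finset.mem_insert, true_or, Finset.insert_eq_of_mem,
        Finset.pair_eq_singleton] at h4
      omega
    have h0 : (2 : ZMod (2 ^ (k + 1))) ^ (k + 1) = 0 := by
      exact_mod_cast ZMod.natCast_self (2 ^ (k + 1))
    refine not_isCohomologicallyTrivial_of_smul_eq_neg hne (by rw [← sq, hpow]) (fun m => ?_)
      (m := ψ (2 ^ k)) ?_ ?_
    · obtain ⟨x, rfl⟩ := ψ.surjective m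
      rw [hu, he, neg_one_mul, map_neg]
    · rw [Ne, EmbeddingLike.map_eq_zero_iff]
      intro h
      have h' := (ZMod.natCast_eq_zero_iff (2 ^ k) (2 ^ (k + 1))).1 (by exact_mod_cast h)
      have := (Nat.pow_dvd_pow_iff_le_right (by norm_num)).1 h'
      omega
    · rw [← map_add, ← two_mul, ← pow_succ', h0, map_zero]
  · have := ZMod.isCyclic_units_of_prime_pow p hp hp2 n
    have hinj : Function.Injective u.toHomUnits := fun a b hab =>
      huinj (congrArg Units.val hab)
    have hE : IsCyclic E := isCyclic_of_injective _ hinj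
    have hdvd : p ^ r ∣ p ^ 1 := by
      rw [← hcard, ← IsCyclic.exponent_eq_card, pow_one]
      exact Monoid.exponent_dvd_of_forall_pow_eq_one hpow
    have := (Nat.pow_dvd_pow_iff_le_right hp.one_lt).1 hdvd
    omega
end

section
/- Let p be a prime and k ≥ 2. If an elementary abelian p-group of rank at least two acts effectively (faithfully) by automorphisms on M = Z/p^k × Z/p, then M is not cohomologically trivial for this action. -/
/-- Vanishing of `Ĥ⁰` on a subgroup: every fixed point is a norm. -/
theorem IsCohomologicallyTrivial.exists_norm_eq {Q M : Type*} [Group Q] [Fintype Q]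
    [AddCommGroup M] [DistribMulAction Q M] (h : IsCohomologicallyTrivial Q M)
    (H : Subgroup Q) [Fintype H] (m : M) (hm : ∀ q ∈ H, q • m = m) :
    ∃ x : M, ∑ q : H, (q : Q) • x = m := by
  obtain ⟨x, hx⟩ := h H 0 m fun q => hm q q.2
  refine ⟨x, ?_⟩
  rw [← hx]
  exact Finset.sum_congr (by ext; simp) fun _ _ => rfl

section ZModPowProd

variable {p k : ℕ} {E : Type*} [Group E] [DistribMulAction E (ZMod (p ^ k) × ZMod p)]

theorem ZMod.prod_eq_val_nsmul_add {m n : ℕ} [NeZero m] [NeZero n] (w : ZMod m × ZMod n) :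
    w = w.1.val • ((1, 0) : ZMod m × ZMod n) + w.2.val • ((0, 1) : ZMod m × ZMod n) := by
  ext <;> simp

/-- An element of order `p` fixes the socle of the cyclic factor `ZMod (p ^ k)`. -/
theorem smul_socle_eq_self [Fact p.Prime] (hk : 2 ≤ k) {e : E} (he : e ^ p = 1) :
    e • (((p : ZMod (p ^ k)) ^ (k - 1), 0) : ZMod (p ^ k) × ZMod p) =
      ((p : ZMod (p ^ k)) ^ (k - 1), 0) := by
  set z : ZMod (p ^ k) × ZMod p := ((p : ZMod (p ^ k)) ^ (k - 1), 0) with hz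
  have hzx : z = p ^ (k - 1) • ((1, 0) : ZMod (p ^ k) × ZMod p) := by
    ext <;> simp [hz]
  have hpz : p • z = 0 := by
    ext
    · have : (p : ZMod (p ^ k)) * (p : ZMod (p ^ k)) ^ (k - 1) = ((p ^ k : ℕ) : ZMod (p ^ k)) := by
        rw [← pow_succ', Nat.sub_add_cancel (by omega)]
        push_cast
        rfl
      simpa [hz] using this
    · simp [hz]
  set w := e • ((1, 0) : ZMod (p ^ k) × ZMod p) with hw
  have hez : e • z = w.1.val • z := by
    rw [hzx, smul_comm e, ← hw]
    ext
    · simp [mul_comm]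
    · have : k - 1 ≠ 0 := by omega
      simp [this]
  have hpow (n : ℕ) : e ^ n • z = w.1.val ^ n • z := by
    induction n with
    | zero => simp
    | succ n ih => rw [pow_succ', mul_smul, ih, smul_comm e, hez, smul_smul, ← pow_succ]
  have hfermat : w.1.val ^ p ≡ w.1.val [MOD addOrderOf z] := by
    refine Nat.ModEq.of_dvd (addOrderOf_dvd_of_nsmul_eq_zero hpz) ?_
    rw [← ZMod.natCast_eq_natCast_iff]
    simp
  rw [hez, ← nsmul_eq_nsmul_iff_modEq.mpr hfermat, ← hpow, he, one_smul]

/-- A group of order at least `p ^ 2` contains a nontrivial element fixing the generator of the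
factor `ZMod p`. -/
theorem exists_ne_one_smul_eq_self [Fact p.Prime] [Finite E] (hE : p ^ 2 ≤ Nat.card E) :
    ∃ e : E, e ≠ 1 ∧
      e • ((0, 1) : ZMod (p ^ k) × ZMod p) = (0, 1) := by
  classical
  set y : ZMod (p ^ k) × ZMod p := (0, 1) with hy
  by_contra! hfix
  have hinj : Function.Injective fun e : E => e • y := fun e f hef => by
    by_contra hne
    refine hfix (f⁻¹ * e) (fun h => hne (inv_mul_eq_one.mp h).symm) ?_
    rw [mul_smul, show e • y = f • y from hef, inv_smul_smul]
  have := Fintype.ofFinite E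
  have hpy : p • y = 0 := by ext <;> simp [hy]
  have hy0 : y ≠ 0 := fun h => one_ne_zero (α := ZMod p) (congrArg Prod.snd h)
  let T : Finset (ZMod (p ^ k) × ZMod p) :=
    (Finset.univ.filter fun a : ZMod (p ^ k) => p • a = 0) ×ˢ Finset.univ
  have hT : T.card ≤ p ^ 2 := by
    rw [Finset.card_product, Finset.card_univ, ZMod.card, sq]
    exact Nat.mul_le_mul_right _
      (IsAddCyclic.card_nsmul_eq_zero_le (Fact.out : p.Prime).pos)
  have hsub : Finset.univ.image (fun e : E => e • y) ⊆ T.erase 0 := by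
    intro m hm
    obtain ⟨e, -, rfl⟩ := Finset.mem_image.mp hm
    have hpe : p • (e • y) = 0 := by rw [smul_comm, hpy, smul_zero]
    have hfst : p • (e • y).1 = 0 := congrArg Prod.fst hpe
    refine Finset.mem_erase.mpr ⟨(smul_ne_zero_iff_ne e).mpr hy0, ?_⟩
    exact Finset.mem_product.mpr ⟨Finset.mem_filter.mpr ⟨Finset.mem_univ _, hfst⟩,
      Finset.mem_univ _⟩
  have h0T : (0 : ZMod (p ^ k) × ZMod p) ∈ T := by simp [T]
  have hcard := Finset.card_le_card hsub
  rw [Finset.card_image_of_injective _ hinj, Finset.card_univ, ← Nat.card_eq_fintype_card] at hcard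
  have := Finset.card_erase_lt_of_mem h0T
  omega

end ZModPowProd

/-- Let `p` be a prime and `k ≥ 2`. If an elementary abelian `p`-group of
rank at least two acts effectively (faithfully) by automorphisms on `M = ℤ/p^k × ℤ/p`, then
`M` is not cohomologically trivial for this action. -/
theorem not_cohomologicallyTrivial_zmod_pow_prod (p k : ℕ) (hp : p.Prime) (hk : 2 ≤ k)
    (E : Type*) [Group E] [Fintype E]
    (hE : ∃ r : ℕ, 2 ≤ r ∧ Nonempty (E ≃* (Fin r → Multiplicative (ZMod p))))
    [DistribMulAction E (ZMod (p ^ k) × ZMod p)]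
    (hfaithful : ∀ e : E, (∀ m : ZMod (p ^ k) × ZMod p, e • m = m) → e = 1) :
    ¬ IsCohomologicallyTrivial E (ZMod (p ^ k) × ZMod p) := by
  intro htriv
  have : Fact p.Prime := ⟨hp⟩
  obtain ⟨r, hr, ⟨φ⟩⟩ := hE
  have hexp (e : E) : e ^ p = 1 := by
    apply φ.injective
    rw [map_pow, map_one]
    funext i
    apply Multiplicative.toAdd.injective
    simp
  have hcardE : p ^ 2 ≤ Nat.card E := by
    rw [Nat.card_congr φ.toEquiv]
    simpa using Nat.pow_le_pow_right hp.pos hr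
  obtain ⟨e, he, hey⟩ := exists_ne_one_smul_eq_self (k := k) hcardE
  have hez := smul_socle_eq_self hk (hexp e)
  set y : ZMod (p ^ k) × ZMod p := (0, 1) with hy
  set z : ZMod (p ^ k) × ZMod p := ((p : ZMod (p ^ k)) ^ (k - 1), 0) with hz
  let H := Subgroup.zpowers e
  have := Fintype.ofFinite H
  have hHfix {m : ZMod (p ^ k) × ZMod p} (hm : e • m = m) (q : E) (hq : q ∈ H) : q • m = m :=
    (Subgroup.zpowers_le (H := MulAction.stabilizer E m)).mpr hm hq
  have hcardH : Fintype.card H = p := by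
    rw [← Nat.card_eq_fintype_card, Nat.card_zpowers]
    exact orderOf_eq_prime (hexp e) he
  have hNy : ∑ q : H, (q : E) • y = 0 := by
    rw [Finset.sum_congr rfl fun (q : H) _ => hHfix hey q q.2, Finset.sum_const, Finset.card_univ,
      hcardH]
    ext <;> simp [hy]
  set v := ∑ q : H, (q : E) • ((1, 0) : ZMod (p ^ k) × ZMod p) with hv
  have hcyclic {m : ZMod (p ^ k) × ZMod p} (hm : e • m = m) : ∃ n : ℕ, n • v = m := by
    obtain ⟨w, rfl⟩ := htriv.exists_norm_eq H m (hHfix hm)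
    refine ⟨w.1.val, ?_⟩
    conv_rhs => rw [ZMod.prod_eq_val_nsmul_add w]
    simp only [smul_add, smul_comm _ w.1.val, smul_comm _ w.2.val, Finset.sum_add_distrib,
      ← Finset.smul_sum]
    rw [← hv, ← hy, hNy, smul_zero, add_zero]
  obtain ⟨n, hn⟩ := hcyclic hey
  obtain ⟨l, hl⟩ := hcyclic hez
  have hn1 : (n : ZMod (p ^ k)) * v.1 = 0 := by simpa [hy] using congrArg Prod.fst hn
  have hn2 : (n : ZMod p) * v.2 = 1 := by simpa [hy] using congrArg Prod.snd hn
  have hcop : n.Coprime (p ^ k) :=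
    ((ZMod.isUnit_iff_coprime n p).mp (IsUnit.of_mul_eq_one _ hn2)).pow_right k
  have hv1 : v.1 = 0 := ((ZMod.isUnit_iff_coprime n (p ^ k)).mpr hcop).mul_right_eq_zero.mp hn1
  have hz1 : (p : ZMod (p ^ k)) ^ (k - 1) = 0 := by
    simpa [hz, hv1] using (congrArg Prod.fst hl).symm
  rw [← Nat.cast_pow, ZMod.natCast_eq_zero_iff, Nat.pow_dvd_pow_iff_le_right hp.one_lt] at hz1
  omega
end

section
/- If an elementary abelian 2-group of rank at least two acts effectively (faithfully) by automorphisms on M = Z/4 × Z/4, then M is not cohomologically trivial for this action. -/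
/-- A square root of the identity among `2 × 2` matrices over `ℤ/4`, all of whose fixed vectors
are norms, has determinant `-1`. -/
theorem zmod4_det_eq_neg_one (p q r s : ZMod 4)
    (h₁ : p * p + q * r = 1) (h₂ : p * q + q * s = 0)
    (h₃ : r * p + s * r = 0) (h₄ : r * q + s * s = 1)
    (hfix : ∀ x y : ZMod 4, p * x + q * y = x → r * x + s * y = y →
      ∃ u v : ZMod 4, u + (p * u + q * v) = x ∧ v + (r * u + s * v) = y) :
    p * s - q * r = -1 := by
  revert p q r s
  decide +kernel

section Action

variable {G : Type*} [Group G] [DistribMulAction G (ZMod 4 × ZMod 4)]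

theorem zmod4_smul_eq (g : G) (m : ZMod 4 × ZMod 4) :
    g • m = m.1 • (g • ((1, 0) : ZMod 4 × ZMod 4)) + m.2 • (g • ((0, 1) : ZMod 4 × ZMod 4)) := by
  have hm : m = m.1 • ((1, 0) : ZMod 4 × ZMod 4) + m.2 • ((0, 1) : ZMod 4 × ZMod 4) := by
    ext <;> simp
  conv_lhs => rw [hm]
  rw [smul_add]
  exact congrArg₂ (· + ·)
    (ZMod.map_smul (DistribSMul.toAddMonoidHom (ZMod 4 × ZMod 4) g) _ _)
    (ZMod.map_smul (DistribSMul.toAddMonoidHom (ZMod 4 × ZMod 4) g) _ _)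

/-- The determinant of the action of `g` on `ℤ/4 × ℤ/4`. -/
def zmod4ActionDet (g : G) : ZMod 4 :=
  (g • ((1, 0) : ZMod 4 × ZMod 4)).1 * (g • ((0, 1) : ZMod 4 × ZMod 4)).2 -
    (g • ((0, 1) : ZMod 4 × ZMod 4)).1 * (g • ((1, 0) : ZMod 4 × ZMod 4)).2

theorem zmod4ActionDet_mul (g h : G) :
    zmod4ActionDet (g * h) = zmod4ActionDet g * zmod4ActionDet h := by
  simp only [zmod4ActionDet, mul_smul]
  rw [zmod4_smul_eq g (h • (1, 0)), zmod4_smul_eq g (h • (0, 1))]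
  simp only [Prod.fst_add, Prod.snd_add, Prod.smul_fst, Prod.smul_snd, smul_eq_mul]
  ring

theorem zmod4ActionDet_eq_neg_one {g : G} (hg : g * g = 1)
    (hfix : ∀ m : ZMod 4 × ZMod 4, g • m = m → ∃ x : ZMod 4 × ZMod 4, x + g • x = m) :
    zmod4ActionDet g = -1 := by
  have hinv (m : ZMod 4 × ZMod 4) : g • g • m = m := by rw [← mul_smul, hg, one_smul]
  have e₁ := hinv (1, 0)
  have e₂ := hinv (0, 1)
  rw [zmod4_smul_eq g (g • _)] at e₁ e₂
  simp only [Prod.ext_iff, Prod.fst_add, Prod.snd_add, Prod.smul_fst, Prod.smul_snd,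
    smul_eq_mul] at e₁ e₂
  refine zmod4_det_eq_neg_one _ _ _ _ ?_ ?_ ?_ ?_ fun x y hx hy => ?_
  · linear_combination e₁.1
  · linear_combination e₂.1
  · linear_combination e₁.2
  · linear_combination e₂.2
  · obtain ⟨⟨u, v⟩, huv⟩ := hfix (x, y) (by
      rw [zmod4_smul_eq]
      ext
      · simpa [mul_comm] using hx
      · simpa [mul_comm] using hy)
    rw [zmod4_smul_eq] at huv
    simp only [Prod.ext_iff, Prod.fst_add, Prod.snd_add, Prod.smul_fst, Prod.smul_snd,
      smul_eq_mul] at huv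
    exact ⟨u, v, by linear_combination huv.1, by linear_combination huv.2⟩

end Action

/-- For an involution `g` acting on a cohomologically trivial module, every element fixed by `g`
is a norm. -/
theorem IsCohomologicallyTrivial.exists_add_smul_eq {G M : Type*} [Group G] [AddCommGroup M]
    [Fintype G] [DistribMulAction G M] (h : IsCohomologicallyTrivial G M) {g : G}
    (hg : g * g = 1) (hne : g ≠ 1) (m : M) (hm : g • m = m) : ∃ x : M, x + g • x = m := by
  classical
  let H : Subgroup G :=
    { carrier := {1, g}
      one_mem' := Or.inl rfl
      mul_mem' := by rintro _ _ (rfl | rfl) (rfl | rfl) <;> simp [hg]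
      inv_mem' := by rintro _ (rfl | rfl) <;> simp [inv_eq_of_mul_eq_one_left hg] }
  let : Fintype H := Fintype.ofFinite H
  let : DistribMulAction H M := DistribMulAction.compHom M H.subtype
  let g' : H := ⟨g, Or.inr rfl⟩
  have hcases (q : H) : q = 1 ∨ q = g' := q.2.imp Subtype.ext Subtype.ext
  have hne' : (1 : H) ≠ g' := fun he => hne (congrArg Subtype.val he).symm
  obtain ⟨x, hx⟩ := h H (Int.ofNat 0) m fun q => by
    rcases hcases q with rfl | rfl
    · exact one_smul G m
    · exact hm
  refine ⟨x, Eq.trans ?_ hx⟩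
  have huniv : (Finset.univ : Finset H) = {1, g'} := by
    ext q
    simpa using hcases q
  rw [huniv, Finset.sum_pair hne']
  exact congrArg (· + g • x) (one_smul G x).symm

/-- An elementary abelian `2`-group of rank at least two contains two distinct involutions. -/
theorem exists_ne_one_ne_one_mul_ne_one {E : Type*} [Group E]
    (hE : ∃ r : ℕ, 2 ≤ r ∧ Nonempty (E ≃* (Fin r → Multiplicative (ZMod 2)))) :
    (∀ g : E, g * g = 1) ∧ ∃ a b : E, a ≠ 1 ∧ b ≠ 1 ∧ a * b ≠ 1 := by
  obtain ⟨r, hr, ⟨e⟩⟩ := hE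
  have hsq : ∀ z : Multiplicative (ZMod 2), z * z = 1 := by decide
  have hgen : Multiplicative.ofAdd (1 : ZMod 2) ≠ 1 := by decide
  let i : Fin r := ⟨0, by omega⟩
  let j : Fin r := ⟨1, by omega⟩
  have hij : i ≠ j := by simp [i, j]
  refine ⟨fun g => e.injective (by ext1 k; simp [hsq]),
    e.symm (Pi.mulSingle i (Multiplicative.ofAdd 1)),
    e.symm (Pi.mulSingle j (Multiplicative.ofAdd 1)), ?_, ?_, ?_⟩
  · simp
  · simp
  · rw [← map_mul, ne_eq, map_eq_one_iff e.symm e.symm.injective]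
    exact fun h => hgen (by simpa [hij] using congrFun h i)

/-- If an elementary abelian `2`-group of rank at least two acts
effectively (faithfully) by automorphisms on `M = ℤ/4 × ℤ/4`, then `M` is not
cohomologically trivial for this action. -/
theorem not_cohomologicallyTrivial_zmod4_zmod4
    (E : Type*) [Group E] [Fintype E]
    (hE : ∃ r : ℕ, 2 ≤ r ∧ Nonempty (E ≃* (Fin r → Multiplicative (ZMod 2))))
    [DistribMulAction E (ZMod 4 × ZMod 4)]
    (hfaithful : ∀ e : E, (∀ m : ZMod 4 × ZMod 4, e • m = m) → e = 1) :
    ¬ IsCohomologicallyTrivial E (ZMod 4 × ZMod 4) := by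
  intro h
  obtain ⟨hsq, a, b, ha, hb, hab⟩ := exists_ne_one_ne_one_mul_ne_one hE
  have hdet (g : E) (hg : g ≠ 1) : zmod4ActionDet g = -1 :=
    zmod4ActionDet_eq_neg_one (hsq g) (h.exists_add_smul_eq (hsq g) hg)
  have hmul := zmod4ActionDet_mul a b
  rw [hdet a ha, hdet b hb, hdet (a * b) hab] at hmul
  exact absurd hmul (by decide)
end

section
/- Let M be a finite abelian 2-group of order at most 2^4 which is cohomologically trivial for an effective (faithful) action by automorphisms of an elementary abelian 2-group of rank at least two. Then M is isomorphic to (Z/2)^4 or to Z/4 × Z/2 × Z/2. -/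
section InvolutionCohomology

variable {A : Type*} [AddCommGroup A]

/-- The subgroup of fixed points of an additive endomorphism. -/
def fixedAddSubgroup (σ : A →+ A) : AddSubgroup A :=
  σ.eqLocus (AddMonoidHom.id A)

theorem mem_fixedAddSubgroup {σ : A →+ A} {a : A} : a ∈ fixedAddSubgroup σ ↔ σ a = a :=
  Iff.rfl

/-- The Herbrand quotient of a finite module over a group of order two is trivial: if every fixed
point of an involution `σ` is a norm, then the same holds for `-σ`, and the order of the module is
the product of the numbers of fixed points of `σ` and `-σ`. -/
theorem herbrand_involution [Finite A] {σ : A →+ A} (hσ : ∀ a, σ (σ a) = a)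
    (hnorm : ∀ a, σ a = a → ∃ x, x + σ x = a) :
    (∀ a, σ a = -a → ∃ x, x - σ x = a) ∧
      Nat.card A = Nat.card (fixedAddSubgroup σ) * Nat.card (fixedAddSubgroup (-σ)) := by
  let p : A →+ A := AddMonoidHom.id A + σ
  let d : A →+ A := AddMonoidHom.id A - σ
  have hp : ∀ a, p a = a + σ a := fun _ => rfl
  have hd : ∀ a, d a = a - σ a := fun _ => rfl
  have kd : d.ker = fixedAddSubgroup σ := by
    ext a
    rw [AddMonoidHom.mem_ker, hd, mem_fixedAddSubgroup, sub_eq_zero, eq_comm]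
  have kp : p.ker = fixedAddSubgroup (-σ) := by
    ext a
    rw [AddMonoidHom.mem_ker, hp, mem_fixedAddSubgroup, AddMonoidHom.neg_apply,
      add_eq_zero_iff_eq_neg, eq_comm]
  have rp : p.range = fixedAddSubgroup σ := by
    ext a
    rw [AddMonoidHom.mem_range, mem_fixedAddSubgroup]
    refine ⟨?_, hnorm a⟩
    rintro ⟨x, rfl⟩
    rw [hp, map_add, hσ, add_comm]
  have cp : Nat.card A = Nat.card p.range * Nat.card p.ker := by
    rw [← AddSubgroup.index_ker, AddSubgroup.index_mul_card]
  have cd : Nat.card A = Nat.card d.range * Nat.card d.ker := by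
    rw [← AddSubgroup.index_ker, AddSubgroup.index_mul_card]
  rw [rp, kp] at cp
  rw [kd, mul_comm, cp] at cd
  have hcard := Nat.eq_of_mul_eq_mul_left Nat.card_pos cd
  have hle : d.range ≤ fixedAddSubgroup (-σ) := by
    rintro _ ⟨x, rfl⟩
    rw [mem_fixedAddSubgroup, AddMonoidHom.neg_apply, hd, map_sub, hσ, neg_sub]
  have heq : d.range = fixedAddSubgroup (-σ) :=
    AddSubgroup.eq_of_le_of_card_ge hle hcard.le
  refine ⟨fun a ha => ?_, cp⟩
  have : a ∈ d.range := by
    rw [heq, mem_fixedAddSubgroup, AddMonoidHom.neg_apply, ha, neg_neg]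
  exact this

/-- Two commuting involutions `σ` and `τ` such that every point fixed by `σ`, by `τ`, or by both
is the norm of some element for the group generated by `σ`, by `τ`, or by both, respectively. -/
structure IsBiacyclic (σ τ : A →+ A) : Prop where
  invol_left : ∀ a, σ (σ a) = a
  invol_right : ∀ a, τ (τ a) = a
  comm : ∀ a, σ (τ a) = τ (σ a)
  norm_left : ∀ a, σ a = a → ∃ x, x + σ x = a
  norm_right : ∀ a, τ a = a → ∃ x, x + τ x = a
  norm_both : ∀ a, σ a = a → τ a = a → ∃ x, x + σ x + τ (x + σ x) = a

namespace IsBiacyclic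

variable {σ τ : A →+ A}

theorem symm (h : IsBiacyclic σ τ) : IsBiacyclic τ σ where
  invol_left := h.invol_right
  invol_right := h.invol_left
  comm a := (h.comm a).symm
  norm_left := h.norm_right
  norm_right := h.norm_left
  norm_both a ha hb := by
    obtain ⟨x, hx⟩ := h.norm_both a hb ha
    refine ⟨x, ?_⟩
    rw [← hx, map_add, map_add, h.comm]
    abel

/-- The Herbrand quotient argument for the action of `τ` on the fixed points of `σ`. -/
theorem herbrand_fixed [Finite A] (h : IsBiacyclic σ τ) :
    (∀ a, σ a = a → τ a = -a → ∃ x, σ x = x ∧ x - τ x = a) ∧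
      Nat.card (fixedAddSubgroup σ) =
        Nat.card (fixedAddSubgroup σ ⊓ fixedAddSubgroup τ : AddSubgroup A) *
          Nat.card (fixedAddSubgroup σ ⊓ fixedAddSubgroup (-τ) : AddSubgroup A) := by
  let P := fixedAddSubgroup σ
  have hP : ∀ a : P, τ a ∈ P := fun a => by
    rw [mem_fixedAddSubgroup, h.comm, mem_fixedAddSubgroup.1 a.2]
  let ρ : P →+ P := (τ.comp P.subtype).codRestrict P hP
  have hρ : ∀ a : P, (ρ a : A) = τ a := fun _ => rfl
  obtain ⟨h₁, h₂⟩ := herbrand_involution (σ := ρ)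
    (fun a => Subtype.ext (h.invol_right a)) (fun a ha => by
      obtain ⟨x, hx⟩ := h.norm_both a a.2 (congrArg Subtype.val ha)
      refine ⟨⟨x + σ x, ?_⟩, Subtype.ext hx⟩
      rw [mem_fixedAddSubgroup, map_add, h.invol_left, add_comm])
  refine ⟨fun a ha hb => ?_, ?_⟩
  · obtain ⟨x, hx⟩ := h₁ ⟨a, ha⟩ (Subtype.ext hb)
    exact ⟨x, x.2, congrArg Subtype.val hx⟩
  · have e : ∀ (υ : A →+ A) (ω : P →+ P), (∀ a : P, (ω a : A) = υ a) →
        Nat.card (fixedAddSubgroup ω) =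
          Nat.card (fixedAddSubgroup σ ⊓ fixedAddSubgroup υ : AddSubgroup A) := by
      intro υ ω hω
      refine Nat.card_congr ⟨fun a => ⟨a.1, a.1.2, ?_⟩, fun a => ⟨⟨a.1, a.2.1⟩, ?_⟩,
        fun _ => rfl, fun _ => rfl⟩
      · exact (hω a.1).symm.trans (congrArg Subtype.val a.2)
      · exact Subtype.ext ((hω _).trans a.2.2)
    rw [← e τ ρ hρ, ← e (-τ) (-ρ) (fun _ => rfl)]
    exact h₂

theorem neg_left [Finite A] (h : IsBiacyclic σ τ) : IsBiacyclic (-σ) τ where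
  invol_left a := by simp [h.invol_left]
  invol_right := h.invol_right
  comm a := by simp [h.comm]
  norm_left a ha := by
    obtain ⟨x, hx⟩ := (herbrand_involution h.invol_left h.norm_left).1 a (neg_eq_iff_eq_neg.1 ha)
    exact ⟨x, by rw [← hx, AddMonoidHom.neg_apply, sub_eq_add_neg]⟩
  norm_right := h.norm_right
  norm_both a ha hb := by
    obtain ⟨y, hy, rfl⟩ := h.symm.herbrand_fixed.1 a hb (neg_eq_iff_eq_neg.1 ha)
    obtain ⟨z, rfl⟩ := h.norm_right y hy
    refine ⟨z, ?_⟩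
    simp only [AddMonoidHom.neg_apply, map_add, map_neg, h.comm]
    abel

/-- In a nontrivial finite `2`-group, two commuting involutions have a common fixed point of
order two. -/
theorem exists_fixed_two_torsion [Finite A] (h : IsBiacyclic σ τ) (hA : 2 ∣ Nat.card A) :
    ∃ z : A, z ≠ 0 ∧ z + z = 0 ∧ σ z = z ∧ τ z = z := by
  obtain ⟨x, hx⟩ := exists_prime_addOrderOf_dvd_card' (G := A) 2 hA
  have hx0 : x ≠ 0 := by
    rintro rfl
    simp at hx
  have hx2 : x + x = 0 := by
    rw [← two_nsmul, ← hx, addOrderOf_nsmul_eq_zero]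
  obtain ⟨y, hy0, hy2, hy⟩ : ∃ y : A, y ≠ 0 ∧ y + y = 0 ∧ σ y = y := by
    by_cases hs : x + σ x = 0
    · exact ⟨x, hx0, hx2, add_left_cancel (hs.trans hx2.symm)⟩
    · refine ⟨x + σ x, hs, ?_, ?_⟩
      · rw [add_add_add_comm, hx2, ← map_add, hx2, map_zero, add_zero]
      · rw [map_add, h.invol_left, add_comm]
  by_cases ht : y + τ y = 0
  · exact ⟨y, hy0, hy2, hy, add_left_cancel (ht.trans hy2.symm)⟩
  · refine ⟨y + τ y, ht, ?_, ?_, ?_⟩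
    · rw [add_add_add_comm, hy2, ← map_add, hy2, map_zero, add_zero]
    · rw [map_add, h.comm, hy]
    · rw [map_add, h.invol_right, add_comm]

/-- If the points fixed by `σ` and fixed up to sign by `τ` all lie in a subgroup `{0, z}`, then the
points fixed by `σ` are killed by two. -/
theorem add_self_eq_zero_of_fixed {z a : A} (h : IsBiacyclic σ τ) (hz : z + z = 0)
    (h₁ : ∀ b, σ b = b → τ b = b → b = 0 ∨ b = z)
    (h₂ : ∀ b, σ b = b → τ b = -b → b = 0 ∨ b = z) (ha : σ a = a) : a + a = 0 := by
  have hz' : ∀ b, b = 0 ∨ b = z → b + b = 0 := by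
    rintro b (rfl | rfl)
    · exact add_zero 0
    · exact hz
  have hp := h₁ (a + τ a) (by rw [map_add, h.comm, ha])
    (by rw [map_add, h.invol_right, add_comm])
  have hm := h₂ (a - τ a) (by rw [map_sub, h.comm, ha])
    (by rw [map_sub, h.invol_right, neg_sub])
  have hsum : a + a = (a + τ a) + (a - τ a) := by abel
  rcases hp with hp | hp
  · exact hz' a (h₂ a ha (eq_neg_of_add_eq_zero_right hp))
  rcases hm with hm | hm
  · exact hz' a (h₁ a ha (sub_eq_zero.1 hm).symm)
  rw [hsum, hp, hm, hz]

/-- A nontrivial finite `2`-group of order at most `16` with a pair of involutions without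
cohomology has order `16`, and its doubles lie in a subgroup of order two. -/
theorem card_and_double [Finite A] (h : IsBiacyclic σ τ) (hA : 2 ∣ Nat.card A)
    (hle : Nat.card A ≤ 16) :
    Nat.card A = 16 ∧ ∃ z : A, z ≠ 0 ∧ z + z = 0 ∧ ∀ x : A, x + x = 0 ∨ x + x = z := by
  obtain ⟨z, hz0, hz2, hσz, hτz⟩ := h.exists_fixed_two_torsion hA
  have hzn : -z = z := neg_eq_of_add_eq_zero_left hz2
  let K (υ ω : A →+ A) : AddSubgroup A := fixedAddSubgroup υ ⊓ fixedAddSubgroup ω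
  have hK2 : ∀ υ ω : A →+ A, z ∈ K υ ω → 2 ≤ Nat.card (K υ ω) := by
    intro υ ω hmem
    have : Nontrivial (K υ ω) := ⟨⟨z, hmem⟩, 0, fun e => hz0 (congrArg Subtype.val e)⟩
    exact Finite.one_lt_card
  have hnσ : (-σ) z = z := by rw [AddMonoidHom.neg_apply, hσz, hzn]
  have hnτ : (-τ) z = z := by rw [AddMonoidHom.neg_apply, hτz, hzn]
  have m₁ : z ∈ K σ τ := ⟨hσz, hτz⟩
  have m₂ : z ∈ K σ (-τ) := ⟨hσz, hnτ⟩
  have m₃ : z ∈ K (-σ) τ := ⟨hnσ, hτz⟩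
  have m₄ : z ∈ K (-σ) (-τ) := ⟨hnσ, hnτ⟩
  have k₁ := hK2 _ _ m₁
  have k₂ := hK2 _ _ m₂
  have k₃ := hK2 _ _ m₃
  have k₄ := hK2 _ _ m₄
  have hcard : Nat.card A = (Nat.card (K σ τ) * Nat.card (K σ (-τ))) *
      (Nat.card (K (-σ) τ) * Nat.card (K (-σ) (-τ))) := by
    rw [(herbrand_involution h.invol_left h.norm_left).2, h.herbrand_fixed.2,
      h.neg_left.herbrand_fixed.2]
  have hbound : ∀ a b c d : ℕ, 2 ≤ a → 2 ≤ b → 2 ≤ c → 2 ≤ d → (a * b) * (c * d) ≤ 16 →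
      a = 2 ∧ b = 2 ∧ c = 2 ∧ d = 2 := by
    intro a b c d ha hb hc hd hprod
    have hab : 2 * 2 ≤ a * b := Nat.mul_le_mul ha hb
    have hcd : 2 * 2 ≤ c * d := Nat.mul_le_mul hc hd
    refine ⟨?_, ?_, ?_, ?_⟩ <;> nlinarith
  obtain ⟨c₁, c₂, c₃, c₄⟩ := hbound _ _ _ _ k₁ k₂ k₃ k₄ (hcard ▸ hle)
  have hKz : ∀ υ ω : A →+ A, z ∈ K υ ω → Nat.card (K υ ω) = 2 →
      ∀ b, υ b = b → ω b = b → b = 0 ∨ b = z := by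
    intro υ ω hmem hc b hυ hω
    by_contra! hb
    have := ((Nat.card_eq_two_iff' (0 : K υ ω)).1 hc).unique
      (show (⟨b, hυ, hω⟩ : K υ ω) ≠ 0 from fun e => hb.1 (congrArg Subtype.val e))
      (show (⟨z, hmem⟩ : K υ ω) ≠ 0 from fun e => hz0 (congrArg Subtype.val e))
    exact hb.2 (congrArg Subtype.val this)
  have l₁ := hKz _ _ m₁ c₁
  have l₂ := hKz _ _ m₂ c₂
  have l₃ := hKz _ _ m₃ c₃
  have l₄ := hKz _ _ m₄ c₄
  have hσp : ∀ x, x + σ x + (x + σ x) = 0 := fun x =>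
    h.add_self_eq_zero_of_fixed hz2 l₁ (fun b hb hb' => l₂ b hb (neg_eq_iff_eq_neg.2 hb'))
      (by rw [map_add, h.invol_left, add_comm])
  have hσm : ∀ x, x + (-σ) x + (x + (-σ) x) = 0 := fun x =>
    h.neg_left.add_self_eq_zero_of_fixed hz2 l₃
      (fun b hb hb' => l₄ b hb (neg_eq_iff_eq_neg.2 hb'))
      (by rw [map_add, h.neg_left.invol_left, add_comm])
  have hτp : ∀ x, x + τ x + (x + τ x) = 0 := fun x =>
    h.symm.add_self_eq_zero_of_fixed hz2 (fun b hb hb' => l₁ b hb' hb)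
      (fun b hb hb' => l₃ b (neg_eq_iff_eq_neg.2 hb') hb)
      (by rw [map_add, h.invol_right, add_comm])
  refine ⟨by rw [hcard, c₁, c₂, c₃, c₄], z, hz0, hz2, fun x => l₁ (x + x) ?_ ?_⟩
  all_goals
    have h4 : x + x + (x + x) = 0 := by
      have := congrArg₂ (· + ·) (hσp x) (hσm x)
      simp only [AddMonoidHom.neg_apply, add_zero] at this
      rw [← this]
      abel
    refine add_left_cancel (Eq.trans ?_ h4.symm)
    rw [map_add, add_add_add_comm]
  · exact hσp x
  · exact hτp x

end IsBiacyclic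

end InvolutionCohomology

/-- The vanishing of `Ĥ⁰(H; M)`, with the subgroup `H` given by the finite set of its elements. -/
theorem exists_sum_smul_eq_of_mem_iff {E M : Type*} [Group E] [Fintype E] [AddCommGroup M]
    [DistribMulAction E M] (htriv : IsCohomologicallyTrivial E M) (H : Subgroup E) (S : Finset E)
    (hS : ∀ e, e ∈ S ↔ e ∈ H) (m : M) (hm : ∀ e ∈ S, e • m = m) :
    ∃ x : M, ∑ e ∈ S, e • x = m := by
  obtain ⟨x, hx⟩ := htriv H 0 m (fun q => hm q ((hS q).2 q.2))
  refine ⟨x, ?_⟩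
  rw [← hx]
  let _ : Fintype H := Fintype.ofFinite H
  exact Finset.sum_subtype S hS (fun e => e • x)

theorem exists_add_smul_eq_of_isCohomologicallyTrivial {E M : Type*} [Group E] [Fintype E]
    [AddCommGroup M] [DistribMulAction E M] (htriv : IsCohomologicallyTrivial E M) {s : E}
    (hs : s * s = 1) (hs1 : s ≠ 1) (m : M) (hm : s • m = m) : ∃ x : M, x + s • x = m := by
  classical
  let H : Subgroup E :=
    { carrier := {1, s}
      one_mem' := by simp
      mul_mem' := by
        rintro a b (rfl | rfl) (rfl | rfl) <;> simp [hs]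
      inv_mem' := by
        rintro a (rfl | rfl) <;> simp [inv_eq_of_mul_eq_one_left hs] }
  obtain ⟨x, hx⟩ := exists_sum_smul_eq_of_mem_iff htriv H {1, s} (fun e => by
    simp only [Finset.mem_insert, Finset.mem_singleton]; rfl) m (by simpa using hm)
  refine ⟨x, ?_⟩
  rw [← hx, Finset.sum_pair hs1.symm, one_smul]

/-- Two distinct commuting involutions in the acting group of a cohomologically trivial module
act as a biacyclic pair. -/
theorem isBiacyclic_of_isCohomologicallyTrivial {E M : Type*} [Group E] [Fintype E]
    [AddCommGroup M] [DistribMulAction E M] (htriv : IsCohomologicallyTrivial E M) {s t : E}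
    (hs : s * s = 1) (ht : t * t = 1) (hst : s * t = t * s) (hs1 : s ≠ 1) (ht1 : t ≠ 1)
    (hne : s ≠ t) :
    IsBiacyclic (DistribSMul.toAddMonoidHom M s) (DistribSMul.toAddMonoidHom M t) where
  invol_left m := by simp [smul_smul, hs]
  invol_right m := by simp [smul_smul, ht]
  comm m := by simp [smul_smul, hst]
  norm_left := exists_add_smul_eq_of_isCohomologicallyTrivial htriv hs hs1
  norm_right := exists_add_smul_eq_of_isCohomologicallyTrivial htriv ht ht1
  norm_both m hσ hτ := by
    classical
    have hs' : s • m = m := hσ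
    have ht' : t • m = m := hτ
    have si : s⁻¹ = s := inv_eq_of_mul_eq_one_left hs
    have ti : t⁻¹ = t := inv_eq_of_mul_eq_one_left ht
    have hts1 : t * s ≠ 1 := fun e => hne (by rw [← inv_eq_of_mul_eq_one_right e, ti])
    have ht2 (a : E) : t * (t * a) = a := by rw [← mul_assoc, ht, one_mul]
    have hst2 (a : E) : s * (t * a) = t * (s * a) := by rw [← mul_assoc, hst, mul_assoc]
    let H : Subgroup E :=
      { carrier := {1, s, t, t * s}
        one_mem' := by simp
        mul_mem' := by
          rintro a b (rfl | rfl | rfl | rfl) (rfl | rfl | rfl | rfl) <;>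
            simp [hs, ht, hst, ht2, hst2, mul_assoc]
        inv_mem' := by
          rintro a (rfl | rfl | rfl | rfl) <;> simp [si, ti, hst] }
    obtain ⟨x, hx⟩ := exists_sum_smul_eq_of_mem_iff htriv H {1, s, t, t * s} (fun e => by
      simp only [Finset.mem_insert, Finset.mem_singleton]; rfl) m (by
        simp [mul_smul, hs', ht'])
    refine ⟨x, ?_⟩
    rw [← hx, Finset.sum_insert (by simp [hs1.symm, ht1.symm, hts1.symm]),
      Finset.sum_insert (by simp [hne, ht1]), Finset.sum_pair (by simp [hs1])]
    simp [mul_smul, add_assoc]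

/-- A vector space over `ZMod 2` with `2 ^ n` elements is `(ZMod 2) ^ n`. -/
theorem nonempty_addEquiv_of_card {V : Type*} [AddCommGroup V] [Finite V] [Module (ZMod 2) V]
    {n : ℕ} (hV : Nat.card V = 2 ^ n) : Nonempty (V ≃+ (Fin n → ZMod 2)) := by
  have hr : Module.finrank (ZMod 2) V = n := by
    have := Module.natCard_eq_pow_finrank (K := ZMod 2) (V := V)
    rw [hV, Nat.card_zmod] at this
    exact (Nat.pow_right_injective le_rfl this).symm
  exact ⟨(LinearEquiv.ofFinrankEq V (Fin n → ZMod 2) (by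
    rw [hr, Module.finrank_fin_fun])).toAddEquiv⟩

/-- The classification of abelian groups of order `16` whose doubles lie in a subgroup of order
two. -/
theorem addEquiv_of_card_of_double {M : Type*} [AddCommGroup M] [Finite M]
    (hM : Nat.card M = 16) {z : M} (hz0 : z ≠ 0) (hz2 : z + z = 0)
    (hdbl : ∀ x : M, x + x = 0 ∨ x + x = z) :
    Nonempty (M ≃+ (Fin 4 → ZMod 2)) ∨ Nonempty (M ≃+ ZMod 4 × ZMod 2 × ZMod 2) := by
  by_cases hall : ∀ x : M, x + x = 0
  · let _ : Module (ZMod 2) M := AddCommGroup.zmodModule (fun x => by rw [two_nsmul, hall])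
    exact Or.inl (nonempty_addEquiv_of_card hM)
  right
  push Not at hall
  obtain ⟨w, hw0⟩ := hall
  have hw : w + w = z := (hdbl w).resolve_left hw0
  let D : M →+ M := AddMonoidHom.id M + AddMonoidHom.id M
  let T := D.ker
  have hrange : Nat.card D.range = 2 := by
    have : (D.range : Set M) = {0, z} := by
      ext x
      constructor
      · rintro ⟨y, rfl⟩
        exact hdbl y
      · rintro (rfl | rfl)
        · exact D.range.zero_mem
        · exact ⟨w, hw⟩
    rw [← SetLike.coe_sort_coe, this, Nat.card_coe_set_eq, Set.ncard_pair hz0.symm]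
  have hTcard : Nat.card T = 8 := by
    have := AddSubgroup.index_mul_card D.ker
    rw [AddSubgroup.index_ker, hrange, hM] at this
    change Nat.card D.ker = 8
    omega
  let _ : Module (ZMod 2) T := AddCommGroup.zmodModule
    (fun x => Subtype.ext (by rw [two_nsmul]; exact x.2))
  let z' : T := ⟨z, hz2⟩
  have hz' : z' ≠ 0 := fun e => hz0 (congrArg Subtype.val e)
  obtain ⟨C, hC⟩ := Submodule.exists_isCompl (Submodule.span (ZMod 2) {z'})
  have hzC : z' ∉ C := fun hmem =>
    hz' (Submodule.disjoint_def.1 hC.disjoint z' (Submodule.mem_span_singleton_self z') hmem)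
  have hCcard : Nat.card C = 2 ^ 2 := by
    have h₁ := Submodule.finrank_add_eq_of_isCompl hC
    rw [finrank_span_singleton hz'] at h₁
    have h₂ := Module.natCard_eq_pow_finrank (K := ZMod 2) (V := T)
    rw [hTcard, Nat.card_zmod, ← h₁] at h₂
    have h₃ := Module.natCard_eq_pow_finrank (K := ZMod 2) (V := C)
    rw [Nat.card_zmod] at h₃
    rw [h₃]
    rw [pow_add] at h₂
    omega
  obtain ⟨e⟩ := nonempty_addEquiv_of_card hCcard
  have hw4 : zmultiplesHom M w (4 : ℕ) = 0 := by
    rw [zmultiplesHom_apply, natCast_zsmul, show 4 = 2 * 2 from rfl, mul_nsmul, two_nsmul,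
      two_nsmul, hw, hz2]
  let f : ZMod 4 →+ M := ZMod.lift 4 ⟨zmultiplesHom M w, hw4⟩
  let g : C →+ M := T.subtype.comp C.subtype.toAddMonoidHom
  let F : ZMod 4 × C →+ M := f.coprod g
  have hf1 : f 1 = w := by
    have := ZMod.lift_coe 4 ⟨zmultiplesHom M w, hw4⟩ 1
    simpa [f] using this
  have hF : Function.Injective F := by
    rw [injective_iff_map_eq_zero]
    rintro ⟨a, c⟩ hac
    have hac' : f a + c = 0 := hac
    have hc2 : ((c : T) : M) + c = 0 := c.1.2
    have hcz : ((c : T) : M) ≠ z := fun h => hzC (by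
      have : (c : T) = z' := Subtype.ext h
      exact this ▸ c.2)
    have hf2 : f 2 = z := by rw [show (2 : ZMod 4) = 1 + 1 from rfl, map_add, hf1, hw]
    have hf3 : f 3 = z + w := by rw [show (3 : ZMod 4) = 2 + 1 from rfl, map_add, hf1, hf2]
    have hcn : f a = c := by
      rw [eq_neg_of_add_eq_zero_left hac', neg_eq_of_add_eq_zero_left hc2]
    have hfa2 : f a + f a = 0 := by rw [hcn, hc2]
    have ha : a = 0 := by
      fin_cases a
      · rfl
      · exact absurd hfa2 (by change f 1 + f 1 ≠ 0; rw [hf1, hw]; exact hz0)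
      · exact absurd (hcn.symm.trans hf2) hcz
      · exact absurd hfa2 (by
          change f 3 + f 3 ≠ 0
          rw [hf3, add_add_add_comm, hw, hz2, zero_add]
          exact hz0)
    subst ha
    rw [map_zero] at hcn
    exact Prod.ext rfl (Subtype.ext (Subtype.ext hcn.symm))
  have hbij : Function.Bijective F := by
    rw [Nat.bijective_iff_injective_and_card]
    refine ⟨hF, ?_⟩
    rw [Nat.card_prod, Nat.card_zmod, hCcard, hM]
    rfl
  exact ⟨(AddEquiv.ofBijective F hbij).symm.trans ((AddEquiv.refl _).prodCongr
    (e.trans (LinearEquiv.finTwoArrow (ZMod 2) (ZMod 2)).toAddEquiv))⟩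

/-- Let `M` be a finite abelian `2`-group of order at most `2^4` which is
cohomologically trivial for an effective (faithful) action by automorphisms of an elementary
abelian `2`-group of rank at least two. Then `M ≅ (ℤ/2)^4` or `M ≅ ℤ/4 × ℤ/2 × ℤ/2`. -/
theorem cohomologicallyTrivial_order_le_sixteen
    (M : Type*) [AddCommGroup M] [Finite M]
    (hM2 : ∃ n : ℕ, Nat.card M = 2 ^ n) (hMle : Nat.card M ≤ 2 ^ 4)
    (E : Type*) [Group E] [Fintype E]
    (hE : ∃ r : ℕ, 2 ≤ r ∧ Nonempty (E ≃* (Fin r → Multiplicative (ZMod 2))))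
    [DistribMulAction E M]
    (hfaithful : ∀ e : E, (∀ m : M, e • m = m) → e = 1)
    (htriv : IsCohomologicallyTrivial E M) :
    Nonempty (M ≃+ (Fin 4 → ZMod 2)) ∨ Nonempty (M ≃+ ZMod 4 × ZMod 2 × ZMod 2) := by
  classical
  obtain ⟨r, hr, ⟨φ⟩⟩ := hE
  let u (i : Fin r) : E := φ.symm (Pi.mulSingle i (Multiplicative.ofAdd 1))
  have hone : (Multiplicative.ofAdd 1 : Multiplicative (ZMod 2)) ≠ 1 := by decide
  have hsq : ∀ e : E, e * e = 1 := fun e => φ.injective (by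
    rw [map_mul, map_one]
    ext i
    have : ∀ a : Multiplicative (ZMod 2), a * a = 1 := by decide
    simp [this])
  have hcomm : ∀ a b : E, a * b = b * a := fun a b => φ.injective (by
    rw [map_mul, map_mul, mul_comm])
  have hu1 : ∀ i, u i ≠ 1 := fun i hi =>
    hone (Pi.mulSingle_eq_one_iff.1 ((map_eq_one_iff φ.symm φ.symm.injective).1 hi))
  let i₀ : Fin r := ⟨0, by omega⟩
  let i₁ : Fin r := ⟨1, by omega⟩
  have hne : u i₀ ≠ u i₁ := fun e => by
    have := congrFun (φ.symm.injective e) i₀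
    rw [Pi.mulSingle_eq_same, Pi.mulSingle_eq_of_ne (by simp [i₀, i₁])] at this
    exact hone this
  have hM : 2 ∣ Nat.card M := by
    obtain ⟨n, hn⟩ := hM2
    rw [hn]
    refine dvd_pow_self 2 fun h0 => hu1 i₀ (hfaithful _ fun m => ?_)
    rw [h0, pow_zero, Nat.card_eq_one_iff_unique] at hn
    exact hn.1.elim _ _
  obtain ⟨hcard, z, hz0, hz2, hdbl⟩ :=
    (isBiacyclic_of_isCohomologicallyTrivial htriv (hsq (u i₀)) (hsq (u i₁)) (hcomm _ _)
      (hu1 i₀) (hu1 i₁) hne).card_and_double hM hMle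
  exact addEquiv_of_card_of_double hcard hz0 hz2 hdbl
end
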